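/- Let Γ be a (3,10,41)-graph. Then the diameter of Γ is either 2 or 3; that is, 2 ≤ diam(Γ) ≤ 3. -/

import Mathlib

namespace R310

/-- Lower bounds for twice the number of edges of a triangle-free graph with independence
number at most `k` (row) on `n` vertices (column); absent columns mean that none exists. -/
def row : ℕ → List ℕ
  | 0 => [0]
  | 1 => [0, 0, 2]
  | 2 => [0, 0, 0, 2, 4, 10]
  | 3 => [0, 0, 0, 0, 2, 4, 6, 12, 20]
  | 4 => [0, 0, 0, 0, 0, 2, 4, 6, 8, 14, 20, 30, 40, 52]
  | 5 => [0, 0, 0, 0, 0, 0, 2, 4, 6, 8, 10, 16, 22, 29, 38, 50, 62, 76, 90]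
  | 6 => [0, 0, 0, 0, 0, 0, 0, 2, 4, 6, 8, 10, 12, 18, 24, 30, 39, 47, 57, 70, 83, 98, 114,
      132]
  | 7 => [0, 0, 0, 0, 0, 0, 0, 0, 2, 4, 6, 8, 10, 12, 14, 20, 26, 32, 39, 48, 57, 66, 77, 89,
      104, 119, 135, 153, 172, 193]
  | _ => []

/-- Table lookup, with `1000` for an impossible number of vertices. -/
def F (k n : ℕ) : ℕ := (row k).getD n 1000

/-- Supporting lines used to derive row `k + 1` from row `k`. -/
def crow : ℕ → List (ℕ × ℕ)
  | 0 => [(0, 0), (0, 2)]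
  | 1 => [(0, 0), (0, 0), (0, 2), (0, 4), (0, 10)]
  | 2 => [(0, 0), (0, 0), (0, 0), (0, 2), (0, 4), (0, 6), (0, 12), (3, 12), (0, 28)]
  | 3 => [(0, 0), (0, 0), (0, 0), (0, 0), (0, 2), (0, 4), (0, 6), (0, 8), (0, 14), (0, 20), (2,
      24), (5, 23), (0, 52)]
  | 4 => [(0, 0), (0, 0), (0, 0), (0, 0), (0, 0), (0, 2), (0, 4), (0, 6), (0, 8), (0, 10), (0,
      16), (0, 22), (1, 26), (0, 38), (4, 36), (4, 46), (8, 40), (6, 60), (0, 102)]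
  | 5 => [(0, 0), (0, 0), (0, 0), (0, 0), (0, 0), (0, 0), (0, 2), (0, 4), (0, 6), (0, 8), (0,
      10), (0, 12), (0, 18), (0, 24), (0, 30), (3, 31), (1, 44), (1, 53), (2, 62), (2, 74), (5,
      74), (8, 72), (8, 86), (5, 115), (0, 162)]
  | 6 => [(0, 0), (0, 0), (0, 0), (0, 0), (0, 0), (0, 0), (0, 0), (0, 2), (0, 4), (0, 6), (0,
      8), (0, 10), (0, 12), (0, 14), (0, 20), (0, 26), (0, 32), (1, 36), (1, 45), (2, 51), (1,
      62), (3, 66), (1, 85), (4, 86), (5, 95), (7, 98), (7, 113), (10, 110), (10, 126), (7,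
      162)]
  | _ => []

/-- Supporting line for the entry `(k + 1, m + 1)`. -/
def C (k m : ℕ) : ℕ × ℕ := (crow k).getD m (0, 1000)

set_option maxRecDepth 100000 in
theorem table_ok : ∀ k < 7, ∀ m < 30,
    (C k m).1 ≤ m + 1 ∧
    (∀ d < k + 2, d ≤ m → (C k m).1 * d + (C k m).2 ≤ F k (m - d) + 2 * (d * d)) ∧
    (F (k + 1) (m + 1) = 0 ∨
      (m + 1) * (F (k + 1) (m + 1) - 1) <
        (C k m).1 * (F (k + 1) (m + 1) - 1) + (C k m).2 * (m + 1) ∨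
      (m + 1) * ((m + 1) * (k + 1)) <
        (C k m).1 * ((m + 1) * (k + 1)) + (C k m).2 * (m + 1)) := by
  decide +kernel

variable {V : Type*} [DecidableEq V] (G : SimpleGraph V) [DecidableRel G.Adj]

/-- Degree inside `S`. -/
def dg (S : Finset V) (v : V) : ℕ := (S.filter (fun w => G.Adj v w)).card

/-- Twice the number of edges inside `S`. -/
def E (S : Finset V) : ℕ := ∑ v ∈ S, dg G S v

/-- Non-neighbours of `v` in `S`. -/
def T (S : Finset V) (v : V) : Finset V := S.filter (fun w => w ≠ v ∧ ¬ G.Adj v w)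

/-- Every independent subset of `S` has at most `k` elements. -/
def Al (S : Finset V) (k : ℕ) : Prop :=
  ∀ I ⊆ S, (∀ x ∈ I, ∀ y ∈ I, ¬ G.Adj x y) → I.card ≤ k

theorem card_T (S : Finset V) (v : V) (hv : v ∈ S) : S.card = (T G S v).card + dg G S v + 1 := by
  have h1 : S = insert v ((T G S v) ∪ (S.filter (fun w => G.Adj v w))) := by
    ext x
    simp only [T, Finset.mem_insert, Finset.mem_union, Finset.mem_filter]
    constructor
    · intro h
      by_cases hx : x = v
      · exact Or.inl hx
      · by_cases ha : G.Adj v x <;> tauto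
    · rintro (rfl | h | h)
      · exact hv
      · exact h.1
      · exact h.1
  conv_lhs => rw [h1]
  rw [Finset.card_insert_of_notMem, Finset.card_union_of_disjoint]
  · rfl
  · rw [Finset.disjoint_left]
    intro x hx hy
    simp only [T, Finset.mem_filter] at hx hy
    exact hx.2.2 hy.2
  · simp [T]

theorem al_T {S : Finset V} {k : ℕ} (h : Al G S (k + 1)) {v : V} (hv : v ∈ S) :
    Al G (T G S v) k := by
  intro I hI hind
  have hvI : v ∉ I := fun hh => by simpa [T] using hI hh
  have := h (insert v I) (by
    intro x hx
    rcases Finset.mem_insert.1 hx with rfl | hx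
    · exact hv
    · exact (Finset.mem_filter.1 (hI hx)).1) (by
    intro x hx y hy
    rcases Finset.mem_insert.1 hx with rfl | hx1 <;>
      rcases Finset.mem_insert.1 hy with rfl | hy1
    · exact G.loopless.irrefl _
    · exact (Finset.mem_filter.1 (hI hy1)).2.2
    · exact fun ha => (Finset.mem_filter.1 (hI hx1)).2.2 ha.symm
    · exact hind x hx1 y hy1)
  rw [Finset.card_insert_of_notMem hvI] at this
  omega

variable {G}

theorem dg_le (htri : ∀ x y z, G.Adj x y → G.Adj x z → ¬ G.Adj y z)
    {S : Finset V} {k : ℕ} (h : Al G S k) (v : V) : dg G S v ≤ k :=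
  h _ (Finset.filter_subset _ _) (by
    intro x hx y hy
    exact htri v x y (Finset.mem_filter.1 hx).2 (Finset.mem_filter.1 hy).2)

theorem E_le (htri : ∀ x y z, G.Adj x y → G.Adj x z → ¬ G.Adj y z)
    {S : Finset V} {k : ℕ} (h : Al G S k) : E G S ≤ S.card * k := by
  unfold E
  simpa using Finset.sum_le_card_nsmul S (dg G S) k (fun v _ => dg_le htri h v)

theorem count (htri : ∀ x y z, G.Adj x y → G.Adj x z → ¬ G.Adj y z) (S : Finset V) :
    ∑ v ∈ S, (E G (T G S v) + 2 * (dg G S v * dg G S v)) ≤ S.card * E G S := by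
  have hE : E G S = ∑ x ∈ S, ∑ y ∈ S, if G.Adj x y then 1 else 0 := by
    simp only [E, dg, Finset.card_filter]
  have hT : ∀ v, E G (T G S v) = ∑ x ∈ S, ∑ y ∈ S,
      if (x ≠ v ∧ ¬ G.Adj v x) ∧ (y ≠ v ∧ ¬ G.Adj v y) ∧ G.Adj x y then 1 else 0 := by
    intro v
    simp only [E, dg, T, Finset.card_filter, Finset.sum_filter]
    refine Finset.sum_congr rfl fun x _ => ?_
    by_cases hx : x ≠ v ∧ ¬ G.Adj v x
    · rw [if_pos hx]
      refine Finset.sum_congr rfl fun y _ => ?_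
      by_cases hy : y ≠ v ∧ ¬ G.Adj v y <;> simp [hx, hy]
    · rw [if_neg hx]
      simp [hx]
  have hD : ∀ x, dg G S x * dg G S x = ∑ y ∈ S, ∑ v ∈ S,
      (if G.Adj x y then 1 else 0) * (if G.Adj x v then 1 else 0) := by
    intro x
    simp only [dg, Finset.card_filter]
    rw [Finset.sum_mul_sum]
  have hD1 : ∑ x ∈ S, dg G S x * dg G S x = ∑ v ∈ S, ∑ x ∈ S, ∑ y ∈ S,
      (if G.Adj x y then 1 else 0) * (if G.Adj x v then 1 else 0) := by
    rw [Finset.sum_comm]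
    refine Finset.sum_congr rfl fun x _ => ?_
    rw [hD, Finset.sum_comm]
  have hD2 : ∑ x ∈ S, dg G S x * dg G S x = ∑ v ∈ S, ∑ x ∈ S, ∑ y ∈ S,
      (if G.Adj x y then 1 else 0) * (if G.Adj y v then 1 else 0) := by
    rw [hD1]
    refine Finset.sum_congr rfl fun v _ => ?_
    rw [Finset.sum_comm]
    refine Finset.sum_congr rfl fun x _ => Finset.sum_congr rfl fun y _ => ?_
    simp only [G.adj_comm y x]
  have hR : S.card * E G S = ∑ v ∈ S, ∑ x ∈ S, ∑ y ∈ S, if G.Adj x y then 1 else 0 := by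
    rw [hE]; simp
  rw [Finset.sum_add_distrib, ← Finset.mul_sum, two_mul, hR]
  nth_rewrite 1 [hD1]
  rw [hD2]
  simp only [hT, ← Finset.sum_add_distrib]
  refine Finset.sum_le_sum fun v _ => Finset.sum_le_sum fun x _ => Finset.sum_le_sum fun y _ => ?_
  by_cases hxy : G.Adj x y
  · have h1 := htri v x y
    have h2 := G.adj_comm v x
    have h3 := G.adj_comm v y
    by_cases hx : G.Adj x v
    · have hy : ¬ G.Adj y v := fun hy => h1 hx.symm hy.symm hxy
      simp [hxy, hx, hy, h2]
    · by_cases hy : G.Adj y v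
      · simp [hxy, hx, hy, h3]
      · simp only [hxy, hx, hy, if_true, if_false]
        split_ifs <;> simp
  · simp [hxy]

theorem bound (htri : ∀ x y z, G.Adj x y → G.Adj x z → ¬ G.Adj y z) :
    ∀ k ≤ 7, ∀ S : Finset V, S.card ≤ 30 → Al G S k → F k S.card ≤ E G S := by
  intro k
  induction k with
  | zero =>
    intro _ S _ hA
    have : S = ∅ := by
      rw [Finset.eq_empty_iff_forall_notMem]
      intro x hx
      have := hA {x} (by simpa using hx) (by simp)
      simp at this
    subst this
    simp [F, row]
  | succ k ih =>
    intro hk S hS hA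
    rcases Nat.eq_zero_or_pos S.card with h0 | hpos
    · rw [h0]
      have : F (k + 1) 0 = 0 := by
        have : k < 7 := by omega
        interval_cases k <;> rfl
      omega
    obtain ⟨m, hm⟩ : ∃ m, S.card = m + 1 := ⟨S.card - 1, by omega⟩
    obtain ⟨t1, t2, t3⟩ := table_ok k (by omega) m (by omega)
    have hc := count htri S
    have hle := E_le htri hA
    have hsum : (C k m).1 * E G S + (C k m).2 * S.card ≤
        ∑ v ∈ S, (E G (T G S v) + 2 * (dg G S v * dg G S v)) := by
      have : (C k m).1 * E G S + (C k m).2 * S.card =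
          ∑ v ∈ S, ((C k m).1 * dg G S v + (C k m).2) := by
        rw [Finset.sum_add_distrib, ← Finset.mul_sum]
        simp [E, mul_comm]
      rw [this]
      refine Finset.sum_le_sum fun v hv => ?_
      have hcard := card_T G S v hv
      have hd := dg_le htri hA v
      have i1 := ih (by omega) (T G S v) (by omega) (al_T G hA hv)
      have i2 := t2 (dg G S v) (by omega) (by omega)
      rw [show (T G S v).card = m - dg G S v by omega] at i1
      omega
    have hmain := hsum.trans hc
    rw [hm] at hmain hle ⊢
    by_contra hlt
    push Not at hlt
    have key : ∀ X, E G S ≤ X →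
        (C k m).1 * X + (C k m).2 * (m + 1) ≤ (m + 1) * X := by
      intro X hX
      obtain ⟨r, rfl⟩ := Nat.exists_eq_add_of_le hX
      have := Nat.mul_le_mul_right r t1
      nlinarith
    rcases t3 with t | t | t
    · omega
    · have := key (F (k + 1) (m + 1) - 1) (by omega)
      omega
    · have := key _ hle
      omega

theorem ramsey (htri : ∀ x y z, G.Adj x y → G.Adj x z → ¬ G.Adj y z) (S : Finset V)
    (hS : 30 ≤ S.card) (hA : Al G S 7) : False := by
  obtain ⟨S', hs, hc⟩ := Finset.exists_subset_card_eq hS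
  have hA' : Al G S' 7 := fun I hI => hA I (hI.trans hs)
  have h1 := bound htri 7 le_rfl S' hc.le hA'
  have h2 := E_le htri hA'
  rw [hc] at h1 h2
  have : F 7 30 = 1000 := rfl
  omega

theorem near (Γ : SimpleGraph (Fin 41)) [DecidableRel Γ.Adj]
    (htri : ∀ x y z, Γ.Adj x y → Γ.Adj x z → ¬ Γ.Adj y z) (hA : Al Γ Finset.univ 9)
    (u v : Fin 41) : Γ.edist u v ≤ 3 := by
  by_contra hcon
  have hw : ∀ p : Γ.Walk u v, 3 < p.length := by
    intro p
    by_contra hp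
    push Not at hp
    exact hcon ((SimpleGraph.edist_le p).trans (by exact_mod_cast hp))
  have w0 : u ≠ v := by
    rintro rfl
    simpa using hw .nil
  have w1 : ¬ Γ.Adj u v := fun h => by simpa using hw (.cons h .nil)
  have w2 : ∀ x, Γ.Adj u x → ¬ Γ.Adj x v := fun x h h' => by
    simpa using hw (.cons h (.cons h' .nil))
  have w3 : ∀ x y, Γ.Adj u x → Γ.Adj x y → ¬ Γ.Adj y v := fun x y h h' h'' => by
    simpa using hw (.cons h (.cons h' (.cons h'' .nil)))
  let N := Finset.univ.filter (fun x => Γ.Adj u x ∨ Γ.Adj v x)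
  have hN : N.card ≤ 9 := by
    refine hA N (Finset.subset_univ _) ?_
    intro x hx y hy hxy
    rcases (Finset.mem_filter.1 hx).2 with hx | hx <;>
      rcases (Finset.mem_filter.1 hy).2 with hy | hy
    · exact htri u x y hx hy hxy
    · exact w3 x y hx hxy hy.symm
    · exact w3 y x hy hxy.symm hx.symm
    · exact htri v x y hx hy hxy
  let W := Finset.univ \ (insert u (insert v N))
  have hWc : 30 ≤ W.card := by
    have h1 : (insert u (insert v N)).card ≤ 11 :=
      (Finset.card_insert_le _ _).trans
        (by have := Finset.card_insert_le v N; omega)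
    have h2 := Finset.le_card_sdiff (insert u (insert v N)) (Finset.univ : Finset (Fin 41))
    have h3 : (Finset.univ : Finset (Fin 41)).card = 41 := by simp
    change 30 ≤ (Finset.univ \ (insert u (insert v N))).card
    omega
  refine ramsey htri W hWc ?_
  intro I hI hind
  have hmem : ∀ x ∈ I, x ≠ u ∧ x ≠ v ∧ ¬ Γ.Adj u x ∧ ¬ Γ.Adj v x := by
    intro x hx
    have := hI hx
    simpa [W, N] using this
  have hvI : v ∉ I := fun h => (hmem v h).2.1 rfl
  have huI : u ∉ insert v I := by
    intro h
    rcases Finset.mem_insert.1 h with h | h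
    · exact w0 h
    · exact (hmem u h).1 rfl
  have := hA (insert u (insert v I)) (Finset.subset_univ _) (by
    intro x hx y hy
    simp only [Finset.mem_insert] at hx hy
    rcases hx with rfl | rfl | hx <;> rcases hy with rfl | rfl | hy
    · exact Γ.loopless.irrefl _
    · exact w1
    · exact (hmem y hy).2.2.1
    · exact fun h => w1 h.symm
    · exact Γ.loopless.irrefl _
    · exact (hmem y hy).2.2.2
    · exact fun h => (hmem x hx).2.2.1 h.symm
    · exact fun h => (hmem x hx).2.2.2 h.symm
    · exact hind x hx y hy)
  rw [Finset.card_insert_of_notMem huI, Finset.card_insert_of_notMem hvI] at this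
  omega

end R310

/-- The diameter of a (3,10,41)-graph is 2 or 3. -/
theorem stmt_6 (Γ : SimpleGraph (Fin 41)) [DecidableRel Γ.Adj]
    (h3 : Γ.CliqueFree 3) (h10 : Γᶜ.CliqueFree 10) :
    2 ≤ Γ.diam ∧ Γ.diam ≤ 3 := by
  have htri : ∀ x y z, Γ.Adj x y → Γ.Adj x z → ¬ Γ.Adj y z := by
    intro x y z hxy hxz hyz
    exact h3 {x, y, z} (SimpleGraph.is3Clique_triple_iff.2 ⟨hxy, hxz, hyz⟩)
  have hA : R310.Al Γ Finset.univ 9 := by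
    intro I _ hind
    by_contra hc
    push Not at hc
    obtain ⟨J, hJ, hJc⟩ := Finset.exists_subset_card_eq (show 10 ≤ I.card by omega)
    refine h10 J ⟨?_, hJc⟩
    intro x hx y hy hxy
    rw [SimpleGraph.compl_adj]
    exact ⟨hxy, hind x (hJ hx) y (hJ hy)⟩
  have hed : Γ.ediam ≤ 3 := SimpleGraph.ediam_le_of_edist_le (R310.near Γ htri hA)
  have hne : Γ.ediam ≠ ⊤ := fun h => by
    rw [h] at hed
    exact absurd hed (by decide)
  have h0 := SimpleGraph.diam_ne_zero_of_ediam_ne_top hne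
  have h1 : Γ.diam ≠ 1 := by
    rw [Ne, SimpleGraph.diam_eq_one]
    intro h
    refine htri 0 1 2 ?_ ?_ ?_ <;> rw [h, SimpleGraph.top_adj] <;> decide
  have hle : Γ.diam ≤ 3 := by
    have := ENat.toNat_le_toNat hed (by decide)
    simpa [SimpleGraph.diam] using this
  omega
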